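/- Let X be a nondegenerate dendrite and h : X → X a homeomorphism. If h fixes an end point e of X, then h fixes some point o ≠ e. -/

import Mathlib

open Set Filter Topology Metric

theorem joinedIn_closedBall_of_refinement {X : Type*} [MetricSpace X] [CompleteSpace X]
    (R : ℕ → X → X → Prop) (hrefl : ∀ n x, R n x x)
    (hdist : ∀ n x y, R n x y → dist x y ≤ (1 / 2 : ℝ) ^ n)
    (hchain : ∀ n, ∃ N, 0 < N ∧ ∀ x y, R n x y → ∃ c : ℕ → X, c 0 = x ∧ c N = y ∧
      ∀ j, R (n + 1) (c j) (c (j + 1)) ∧ dist x (c j) ≤ (1 / 2 : ℝ) ^ n)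
    {m : ℕ} {x y : X} (hxy : R m x y) :
    JoinedIn (closedBall x (3 * (1 / 2 : ℝ) ^ m)) x y := by
  have hchain' : ∀ n, ∃ N, 0 < N ∧ ∃ c : X → X → ℕ → X, ∀ x y, R n x y →
      c x y 0 = x ∧ c x y N = y ∧
      ∀ j, R (n + 1) (c x y j) (c x y (j + 1)) ∧ dist x (c x y j) ≤ (1 / 2 : ℝ) ^ n := by
    intro n
    obtain ⟨N, hN, hc⟩ := hchain n
    have : ∀ x y, ∃ c : ℕ → X, R n x y → c 0 = x ∧ c N = y ∧
      ∀ j, R (n + 1) (c j) (c (j + 1)) ∧ dist x (c j) ≤ (1 / 2 : ℝ) ^ n := by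
      intro x y
      by_cases h : R n x y
      · obtain ⟨c, hc⟩ := hc x y h
        exact ⟨c, fun _ => hc⟩
      · exact ⟨fun _ => x, fun h' => absurd h' h⟩
    choose c hc using this
    exact ⟨N, hN, c, hc⟩
  choose N hN c hc using hchain'
  obtain ⟨T, T0, Ts⟩ : ∃ T : ℕ → ℕ, T 0 = 1 ∧ ∀ k, T (k + 1) = T k * N (m + k) :=
    ⟨fun k => Nat.rec 1 (fun k t => t * N (m + k)) k, rfl, fun _ => rfl⟩
  have Tpos : ∀ k, 0 < T k := by
    intro k
    induction k with
    | zero => simp [T0]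
    | succ k ih => rw [Ts]; exact Nat.mul_pos ih (hN _)
  obtain ⟨z, z0, zs⟩ : ∃ z : ℕ → ℕ → X, (∀ i, z 0 i = if i = 0 then x else y) ∧
      ∀ k i, z (k + 1) i = c (m + k) (z k (i / N (m + k))) (z k (i / N (m + k) + 1))
        (i % N (m + k)) :=
    ⟨fun k => Nat.rec (fun i => if i = 0 then x else y)
      (fun k w i => c (m + k) (w (i / N (m + k))) (w (i / N (m + k) + 1)) (i % N (m + k))) k,
      fun _ => rfl, fun _ _ => rfl⟩
  have hR : ∀ k i, R (m + k) (z k i) (z k (i + 1)) := by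
    intro k
    induction k with
    | zero =>
      intro i
      rw [z0, z0]
      by_cases hi : i = 0
      · simpa [hi] using hxy
      · simpa [hi] using hrefl _ _
    | succ k ih =>
      intro i
      rw [zs, zs]
      have hNk := hN (m + k)
      set M := N (m + k)
      have key := (hc (m + k) _ _ (ih (i / M))).2.2 (i % M)
      rcases Nat.lt_or_ge (i % M + 1) M with h | h
      · have h1 : (i + 1) / M = i / M := by
          rw [Nat.succ_div_of_not_dvd]
          intro hd
          have := Nat.mod_eq_zero_of_dvd hd
          rw [Nat.add_mod, Nat.mod_eq_of_lt (a := i % M + 1 % M)] at this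
          · rcases Nat.lt_or_ge 1 M with h1 | h1
            · rw [Nat.mod_eq_of_lt h1] at this; omega
            · omega
          · rw [Nat.mod_eq_of_lt (a := 1) (by omega)]; exact h
        have h2 : (i + 1) % M = i % M + 1 := by
          rw [Nat.add_mod, Nat.mod_eq_of_lt (a := 1) (by omega), Nat.mod_eq_of_lt h]
        rw [h1, h2]
        exact key.1
      · have hlt := Nat.mod_lt i hNk
        have h3 : i % M + 1 = M := by omega
        have h4 : i + 1 = M * (i / M + 1) := by
          have := Nat.div_add_mod i M
          rw [mul_add]; omega
        have h1 : (i + 1) / M = i / M + 1 := by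
          rw [h4, Nat.mul_div_cancel_left _ hNk]
        have h2 : (i + 1) % M = 0 := by rw [h4, Nat.mul_mod_right]
        rw [h1, h2, (hc (m + k) _ _ (ih (i / M + 1))).1]
        have h5 := key.1
        rw [h3, (hc (m + k) _ _ (ih (i / M))).2.1] at h5
        exact h5
  let f : ℕ → ℝ → X := fun k t => z k ⌊t * (T k : ℝ)⌋₊
  have hf : ∀ t k, dist (f k t) (f (k + 1) t) ≤ (1 / 2 : ℝ) ^ m * (1 / 2) ^ k := by
    intro t k
    have hNk := hN (m + k)
    have e : ⌊t * T (k + 1)⌋₊ / N (m + k) = ⌊t * T k⌋₊ := by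
      rw [← Nat.floor_div_natCast, Ts]
      congr 1
      have : (N (m + k) : ℝ) ≠ 0 := by positivity
      push_cast
      field_simp
    change dist (z k _) (z (k + 1) _) ≤ _
    rw [zs, e, ← pow_add]
    exact ((hc (m + k) _ _ (hR k _)).2.2 _).2
  have hlim : ∀ t, ∃ a, Tendsto (fun k => f k t) atTop (𝓝 a) := fun t =>
    cauchySeq_tendsto_of_complete (cauchySeq_of_le_geometric (1 / 2) _ (by norm_num) (hf t))
  choose F hF using hlim
  have hFd : ∀ t k, dist (f k t) (F t) ≤ 2 * (1 / 2 : ℝ) ^ m * (1 / 2) ^ k := by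
    intro t k
    have := dist_le_of_le_geometric_of_tendsto (1 / 2) _ (by norm_num) (hf t) (hF t) k
    refine this.trans (le_of_eq ?_)
    ring
  have hclose : ∀ k, ∀ s t : ℝ, 0 ≤ s → s ≤ t → t - s < 1 / T k →
      dist (F s) (F t) ≤ 5 * (1 / 2 : ℝ) ^ m * (1 / 2) ^ k := by
    intro k s t hs hst hlt
    have hT : (0 : ℝ) < T k := by exact_mod_cast Tpos k
    have h1 : ⌊s * T k⌋₊ ≤ ⌊t * T k⌋₊ := Nat.floor_le_floor (mul_le_mul_of_nonneg_right hst hT.le)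
    have h2 : ⌊t * T k⌋₊ ≤ ⌊s * T k⌋₊ + 1 := by
      rw [← Nat.floor_add_one (by positivity)]
      apply Nat.floor_le_floor
      rw [lt_div_iff₀ hT] at hlt
      linarith
    have h3 : dist (f k s) (f k t) ≤ (1 / 2 : ℝ) ^ m * (1 / 2) ^ k := by
      change dist (z k _) (z k _) ≤ _
      rcases (by omega : ⌊t * T k⌋₊ = ⌊s * T k⌋₊ ∨ ⌊t * T k⌋₊ = ⌊s * T k⌋₊ + 1) with h | h
      · rw [h, dist_self]; positivity
      · rw [h, ← pow_add]; exact hdist _ _ _ (hR k _)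
    have h4 := hFd s k
    have h5 := hFd t k
    have h6 := dist_triangle4 (F s) (f k s) (f k t) (F t)
    rw [dist_comm (F s) (f k s)] at h6
    linarith
  have hcont : ContinuousOn F (Icc 0 1) := by
    rw [Metric.continuousOn_iff]
    intro t ht ε hε
    have h1 : Tendsto (fun k : ℕ => 5 * (1 / 2 : ℝ) ^ m * (1 / 2) ^ k) atTop
        (𝓝 (5 * (1 / 2 : ℝ) ^ m * 0)) :=
      (tendsto_pow_atTop_nhds_zero_of_lt_one (by norm_num) (by norm_num)).const_mul _
    rw [mul_zero] at h1
    obtain ⟨k, hk⟩ := (h1.eventually (gt_mem_nhds hε)).exists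
    have hT : (0 : ℝ) < T k := by exact_mod_cast Tpos k
    refine ⟨1 / T k, by positivity, fun s hs hst => lt_of_le_of_lt ?_ hk⟩
    rw [Real.dist_eq, abs_lt] at hst
    rcases le_total s t with h | h
    · exact hclose k s t hs.1 h (by linarith)
    · rw [dist_comm]; exact hclose k t s ht.1 h (by linarith)
  have hF0 : F 0 = x := by
    refine tendsto_nhds_unique (hF 0) (tendsto_const_nhds.congr fun k => ?_)
    change x = z k _
    rw [zero_mul, Nat.floor_zero]
    induction k with
    | zero => simp [z0]
    | succ k ih =>
      rw [zs, Nat.zero_mod, Nat.zero_div, (hc (m + k) _ _ (hR k 0)).1]; exact ih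
  have hF1 : F 1 = y := by
    refine tendsto_nhds_unique (hF 1) (tendsto_const_nhds.congr fun k => ?_)
    change y = z k _
    rw [one_mul, Nat.floor_natCast]
    induction k with
    | zero => simp [z0, T0]
    | succ k ih =>
      rw [zs, Ts, Nat.mul_mod_left, Nat.mul_div_cancel _ (hN _), (hc (m + k) _ _ (hR k _)).1]
      exact ih
  refine JoinedIn.ofLine hcont hF0 hF1 ?_
  rintro _ ⟨t, ht, rfl⟩
  have h1 : dist (f 0 t) x ≤ (1 / 2 : ℝ) ^ m := by
    change dist (z 0 _) x ≤ _
    rw [z0]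
    split_ifs
    · rw [dist_self]; positivity
    · rw [dist_comm]; exact hdist _ _ _ hxy
  have h2 := hFd t 0
  have h3 := dist_triangle_left (F t) x (f 0 t)
  rw [mem_closedBall]
  rw [pow_zero] at h2
  linarith

/-- `x` and `y` are joined by `k` steps inside `U`, each within a member of `𝒱`. -/
def ChainIn {X : Type*} (U : Set X) (𝒱 : Set (Set X)) (k : ℕ) (x y : X) : Prop :=
  ∃ c : ℕ → X, c 0 = x ∧ (∀ j, k ≤ j → c j = y) ∧
    ∀ j, c j ∈ U ∧ ∃ V ∈ 𝒱, c j ∈ V ∧ c (j + 1) ∈ V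

theorem ChainIn.mono {X : Type*} {U : Set X} {𝒱 : Set (Set X)} {k l : ℕ} {x y : X}
    (h : ChainIn U 𝒱 k x y) (hkl : k ≤ l) : ChainIn U 𝒱 l x y := by
  obtain ⟨c, h0, h1, h2⟩ := h
  exact ⟨c, h0, fun j hj => h1 j (hkl.trans hj), h2⟩

theorem ChainIn.trans {X : Type*} {U : Set X} {𝒱 : Set (Set X)} {k l : ℕ} {x y z : X}
    (h : ChainIn U 𝒱 k x y) (h' : ChainIn U 𝒱 l y z) : ChainIn U 𝒱 (k + l) x z := by
  obtain ⟨c, h0, h1, h2⟩ := h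
  obtain ⟨d, g0, g1, g2⟩ := h'
  refine ⟨fun j => if j < k then c j else d (j - k), ?_, fun j hj => ?_, fun j => ?_⟩
  · by_cases hk : 0 < k
    · simpa [hk] using h0
    · have := h1 0 (by omega)
      simp only [hk, if_false]
      rw [Nat.zero_sub, g0, ← this, h0]
  · simp only [show ¬ j < k by omega, if_false]
    exact g1 _ (by omega)
  · by_cases hj : j < k
    · by_cases hj' : j + 1 < k
      · simpa [hj, hj'] using h2 j
      · have e : j + 1 = k := by omega
        have e2 := h2 j
        rw [h1 (j + 1) (by omega), ← g0] at e2
        simpa [hj, e] using e2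
    · have e : j + 1 - k = j - k + 1 := by omega
      simp only [hj, show ¬ j + 1 < k by omega, if_false, e]
      exact g2 _

theorem ChainIn.of_mem {X : Type*} {U V : Set X} {𝒱 : Set (Set X)} {x y : X}
    (hV : V ∈ 𝒱) (hxU : x ∈ U) (hyU : y ∈ U) (hxV : x ∈ V) (hyV : y ∈ V) :
    ChainIn U 𝒱 1 x y := by
  refine ⟨fun j => if j = 0 then x else y, rfl, fun j hj => ?_, fun j => ?_⟩
  · simp [show j ≠ 0 by omega]
  · by_cases hj : j = 0
    · simpa [hj] using ⟨hxU, V, hV, hxV, hyV⟩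
    · simpa [hj] using ⟨hyU, V, hV, hyV⟩

theorem exists_uniform_chainIn {X : Type*} [TopologicalSpace X] {U : Set X} {𝒱 : Set (Set X)}
    (hfin : 𝒱.Finite) (hopen : ∀ V ∈ 𝒱, IsOpen V) (hcov : ∀ x, ∃ V ∈ 𝒱, x ∈ V)
    (hU : IsPreconnected U) : ∃ N, ∀ x ∈ U, ∀ y ∈ U, ChainIn U 𝒱 N x y := by
  have h1 : ∀ x ∈ U, ∀ y ∈ U, ∃ k, ChainIn U 𝒱 k x y := by
    intro x hx y hy
    refine hU.induction₂' (fun x y => ∃ k, ChainIn U 𝒱 k x y) (fun a ha => ?_) ?_ hx hy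
    · obtain ⟨V, hV, haV⟩ := hcov a
      filter_upwards [mem_nhdsWithin_of_mem_nhds ((hopen V hV).mem_nhds haV),
        self_mem_nhdsWithin] with b hbV hbU
      exact ⟨⟨1, .of_mem hV ha hbU haV hbV⟩, ⟨1, .of_mem hV hbU ha hbV haV⟩⟩
    · rintro a b c - - - ⟨k, hk⟩ ⟨l, hl⟩
      exact ⟨_, hk.trans hl⟩
  have h2 : ∀ p : Set X × Set X, ∃ k, p ∈ 𝒱 ×ˢ 𝒱 → ∀ x ∈ U ∩ p.1, ∀ y ∈ U ∩ p.2,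
      ChainIn U 𝒱 k x y := by
    rintro ⟨V, V'⟩
    by_cases hne : (U ∩ V).Nonempty ∧ (U ∩ V').Nonempty
    · obtain ⟨⟨a, ha⟩, ⟨b, hb⟩⟩ := hne
      obtain ⟨k, hk⟩ := h1 a ha.1 b hb.1
      exact ⟨1 + k + 1, fun hp x hx y hy => ((ChainIn.of_mem hp.1 hx.1 ha.1 hx.2 ha.2).trans
        hk).trans (.of_mem hp.2 hb.1 hy.1 hb.2 hy.2)⟩
    · exact ⟨0, fun _ x hx y hy => absurd ⟨⟨x, hx⟩, ⟨y, hy⟩⟩ hne⟩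
  choose K hK using h2
  obtain ⟨N, hN⟩ := ((hfin.prod hfin).image K).bddAbove
  refine ⟨N, fun x hx y hy => ?_⟩
  obtain ⟨V, hV, hxV⟩ := hcov x
  obtain ⟨V', hV', hyV'⟩ := hcov y
  exact (hK (V, V') ⟨hV, hV'⟩ x ⟨hx, hxV⟩ y ⟨hy, hyV'⟩).mono
    (hN (mem_image_of_mem K (show (V, V') ∈ 𝒱 ×ˢ 𝒱 from ⟨hV, hV'⟩)))

theorem exists_finite_connected_cover {X : Type*} [MetricSpace X] [CompactSpace X]
    [LocallyConnectedSpace X] {ε : ℝ} (hε : 0 < ε) :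
    ∃ 𝒱 : Set (Set X), 𝒱.Finite ∧ (∀ V ∈ 𝒱, IsOpen V ∧ IsPreconnected V ∧
      ∀ x ∈ V, ∀ y ∈ V, dist x y ≤ ε) ∧ ∀ x, ∃ V ∈ 𝒱, x ∈ V := by
  have h : ∀ x : X, ∃ V ⊆ ball x (ε / 2), IsOpen V ∧ x ∈ V ∧ IsConnected V := fun x =>
    locallyConnectedSpace_iff_subsets_isOpen_isConnected.1 ‹_› x _ (ball_mem_nhds x (by linarith))
  choose V hVb hVo hxV hVc using h
  obtain ⟨t, ht⟩ := isCompact_univ.elim_finite_subcover V hVo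
    (fun x _ => mem_iUnion.2 ⟨x, hxV x⟩)
  refine ⟨V '' t, t.finite_toSet.image V, ?_, fun x => ?_⟩
  · rintro _ ⟨a, -, rfl⟩
    refine ⟨hVo a, (hVc a).isPreconnected, fun x hx y hy => ?_⟩
    have h1 := mem_ball.1 (hVb a hx)
    have h2 := mem_ball.1 (hVb a hy)
    have := dist_triangle_right x y a
    linarith
  · obtain ⟨a, ha, hxa⟩ := mem_iUnion₂.1 (ht (mem_univ x))
    exact ⟨V a, mem_image_of_mem V ha, hxa⟩

theorem IsPreconnected.joinedIn_of_isOpen {X : Type*} [MetricSpace X] [CompactSpace X]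
    [LocallyConnectedSpace X] {W : Set X} (hW : IsPreconnected W) (hWo : IsOpen W) {x y : X}
    (hx : x ∈ W) (hy : y ∈ W) : JoinedIn W x y := by
  have hcov := fun n : ℕ => exists_finite_connected_cover (X := X) (ε := (1 / 2 : ℝ) ^ n)
    (by positivity)
  choose 𝒱 hfin hV hcov using hcov
  let R : ℕ → X → X → Prop := fun n x y => ∃ V ∈ 𝒱 n, x ∈ V ∧ y ∈ V
  have key : ∀ m x y, R m x y → JoinedIn (closedBall x (3 * (1 / 2 : ℝ) ^ m)) x y := by
    intro m x y hxy
    refine joinedIn_closedBall_of_refinement R (fun n x => ?_) ?_ (fun n => ?_) hxy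
    · obtain ⟨V, hV, hx⟩ := hcov n x
      exact ⟨V, hV, hx, hx⟩
    · rintro n x y ⟨V, hVn, hx, hy⟩
      exact (hV n V hVn).2.2 x hx y hy
    · have h1 : ∀ U, ∃ N, U ∈ 𝒱 n → ∀ x ∈ U, ∀ y ∈ U, ChainIn U (𝒱 (n + 1)) N x y := by
        intro U
        by_cases hU : U ∈ 𝒱 n
        · obtain ⟨N, hN⟩ := exists_uniform_chainIn (hfin (n + 1))
            (fun V h => (hV _ V h).1) (hcov (n + 1)) (hV n U hU).2.1
          exact ⟨N, fun _ => hN⟩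
        · exact ⟨0, fun h => absurd h hU⟩
      choose K hK using h1
      obtain ⟨N, hN⟩ := ((hfin n).image K).bddAbove
      refine ⟨N + 1, N.succ_pos, ?_⟩
      rintro x y ⟨U, hU, hx, hy⟩
      obtain ⟨c, h0, h1, h2⟩ := (hK U hU x hx y hy).mono (hN (mem_image_of_mem K hU))
      exact ⟨c, h0, h1 _ N.le_succ, fun j =>
        ⟨(h2 j).2, (hV n U hU).2.2 x hx _ (h2 j).1⟩⟩
  refine hW.induction₂ (JoinedIn W) (fun a ha => ?_) (fun a b c _ _ _ h h' => h.trans h')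
    (fun a b _ _ h => h.symm) hx hy
  obtain ⟨ε, hε, hball⟩ := Metric.isOpen_iff.1 hWo a ha
  have h1 : Tendsto (fun k : ℕ => 3 * (1 / 2 : ℝ) ^ k) atTop (𝓝 (3 * 0)) :=
    (tendsto_pow_atTop_nhds_zero_of_lt_one (by norm_num) (by norm_num)).const_mul _
  rw [mul_zero] at h1
  obtain ⟨m, hm⟩ := (h1.eventually (gt_mem_nhds hε)).exists
  obtain ⟨V, hVm, haV⟩ := hcov m a
  filter_upwards [mem_nhdsWithin_of_mem_nhds ((hV m V hVm).1.mem_nhds haV)] with b hb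
  exact (key m a b ⟨V, hVm, haV, hb⟩).mono ((closedBall_subset_ball hm).trans hball)

/-- In every gap of `K` the map `γ` takes the same value at both ends. -/
def GapsClosed {X : Type*} (γ : ℝ → X) (K : Set ℝ) : Prop :=
  ∀ a ∈ K, ∀ b ∈ K, a < b → (∀ r ∈ K, a < r → r < b → False) → γ a = γ b

theorem GapsClosed.sInter {X : Type*} [MetricSpace X] {γ : ℝ → X} (hγ : Continuous γ)
    {c : Set (Set ℝ)} (hc : IsChain (· ⊆ ·) c) (hne : c.Nonempty)
    (hclosed : ∀ K ∈ c, IsClosed K) (hgap : ∀ K ∈ c, GapsClosed γ K) :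
    GapsClosed γ (⋂₀ c) := by
  intro a ha b hb hab hr
  by_contra hne'
  have hd : 0 < dist (γ a) (γ b) / 2 := by have := dist_pos.2 hne'; linarith
  obtain ⟨δ₁, hδ₁, h1⟩ := Metric.continuous_iff.1 hγ a _ hd
  obtain ⟨δ₂, hδ₂, h2⟩ := Metric.continuous_iff.1 hγ b _ hd
  obtain ⟨δ, hδ, hlt⟩ : ∃ δ : ℝ, 0 < δ ∧ δ < δ₁ ∧ δ < δ₂ ∧ δ < (b - a) / 2 := by
    obtain ⟨δ, h, h'⟩ := exists_between (lt_min (lt_min hδ₁ hδ₂) (by linarith : 0 < (b - a) / 2))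
    exact ⟨δ, h, by simpa [and_assoc] using h'⟩
  obtain ⟨hδ1, hδ2, hδ3⟩ := hlt
  have hK : ∃ K ∈ c, K ∩ Icc (a + δ) (b - δ) = ∅ := by
    by_contra! hcon
    have : Nonempty c := hne.to_subtype
    obtain ⟨r, hr'⟩ := IsCompact.nonempty_iInter_of_directed_nonempty_isCompact_isClosed
      (fun K : c => (K : Set ℝ) ∩ Icc (a + δ) (b - δ)) (by
        intro K L
        rcases hc.total K.2 L.2 with h | h
        · exact ⟨K, subset_rfl, inter_subset_inter_left _ h⟩
        · exact ⟨L, inter_subset_inter_left _ h, subset_rfl⟩)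
      (fun K => hcon K K.2)
      (fun K => isCompact_Icc.inter_left (hclosed K K.2))
      (fun K => (hclosed K K.2).inter isClosed_Icc)
    rw [mem_iInter] at hr'
    obtain ⟨K, hK⟩ := hne
    have := (hr' ⟨K, hK⟩).2
    exact hr r (fun L hL => (hr' ⟨L, hL⟩).1) (by linarith [this.1]) (by linarith [this.2])
  obtain ⟨K, hK, hempty⟩ := hK
  obtain ⟨a', ha', ha'm⟩ := (isCompact_Icc.inter_left (hclosed K hK)).exists_isGreatest
    (s := K ∩ Icc a (a + δ)) ⟨a, ha K hK, le_rfl, by linarith⟩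
  obtain ⟨b', hb', hb'm⟩ := (isCompact_Icc.inter_left (hclosed K hK)).exists_isLeast
    (s := K ∩ Icc (b - δ) b) ⟨b, hb K hK, by linarith, le_rfl⟩
  have e : γ a' = γ b' := by
    refine hgap K hK a' ha'.1 b' hb'.1 (by linarith [ha'.2.2, hb'.2.1]) fun r hrK h3 h4 => ?_
    rcases le_or_gt r (a + δ) with h5 | h5
    · exact absurd (ha'm ⟨hrK, by linarith [ha'.2.1], h5⟩) (not_le.2 h3)
    · rcases le_or_gt (b - δ) r with h6 | h6
      · exact absurd (hb'm ⟨hrK, h6, by linarith [hb'.2.2]⟩) (not_le.2 h4)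
      · exact (hempty ▸ (⟨hrK, h5.le, h6.le⟩ : r ∈ K ∩ Icc (a + δ) (b - δ)) : r ∈ (∅ : Set ℝ))
  have h5 := h1 a' (by rw [Real.dist_eq, abs_lt]; constructor <;> linarith [ha'.2.1, ha'.2.2])
  have h6 := h2 b' (by rw [Real.dist_eq, abs_lt]; constructor <;> linarith [hb'.2.1, hb'.2.2])
  rw [e] at h5
  have := dist_triangle_left (γ a) (γ b) (γ b')
  linarith

theorem exists_minimal_gapsClosed {X : Type*} [MetricSpace X] {γ : ℝ → X} (hγ : Continuous γ) :
    ∃ K ⊆ Icc (0 : ℝ) 1, IsClosed K ∧ 0 ∈ K ∧ 1 ∈ K ∧ GapsClosed γ K ∧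
      ∀ s ∈ K, ∀ t ∈ K, γ s = γ t → ∀ r ∈ K, s < r → r < t → False := by
  let S : Set (Set ℝ) := {K | K ⊆ Icc 0 1 ∧ IsClosed K ∧ 0 ∈ K ∧ 1 ∈ K ∧ GapsClosed γ K}
  obtain ⟨K, -, hK⟩ := zorn_superset_nonempty S (fun c hcS hc hne => by
    refine ⟨⋂₀ c, ⟨?_, ?_, ?_, ?_, ?_⟩, fun s hs => sInter_subset_of_mem hs⟩
    · obtain ⟨L, hL⟩ := hne
      exact (sInter_subset_of_mem hL).trans (hcS hL).1
    · exact isClosed_sInter fun L hL => (hcS hL).2.1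
    · exact fun L hL => (hcS hL).2.2.1
    · exact fun L hL => (hcS hL).2.2.2.1
    · exact GapsClosed.sInter hγ hc hne (fun L hL => (hcS hL).2.1)
        (fun L hL => (hcS hL).2.2.2.2)) (Icc 0 1) ⟨subset_rfl, isClosed_Icc, by simp, by simp,
      fun a ha b hb hab h => (h ((a + b) / 2) ⟨by linarith [ha.1, hb.1], by linarith [ha.2, hb.2]⟩
        (by linarith) (by linarith)).elim⟩
  obtain ⟨h01, hcl, h0, h1, hgap⟩ := hK.prop
  refine ⟨K, h01, hcl, h0, h1, hgap, fun s hs t ht hst r hr hsr hrt => ?_⟩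
  have hL : K \ Ioo s t ∈ S := by
    refine ⟨sdiff_subset.trans h01, hcl.sdiff isOpen_Ioo, ⟨h0, fun h => ?_⟩, ⟨h1, fun h => ?_⟩, ?_⟩
    · exact absurd (h01 hs).1 (not_le.2 h.1)
    · exact absurd (h01 ht).2 (not_le.2 h.2)
    · intro a ha b hb hab hno
      by_cases hex : ∃ q ∈ K, a < q ∧ q < b
      · obtain ⟨q, hq, haq, hqb⟩ := hex
        have hqI : q ∈ Ioo s t := by
          by_contra hqI
          exact hno q ⟨hq, hqI⟩ haq hqb
        have has : a ≤ s := by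
          by_contra! h
          exact ha.2 ⟨h, haq.trans hqI.2⟩
        have htb : t ≤ b := by
          by_contra! h
          exact hb.2 ⟨hqI.1.trans hqb, h⟩
        have e1 : a = s := by
          by_contra hne
          exact hno s ⟨hs, fun h => lt_irrefl _ h.1⟩ (lt_of_le_of_ne has hne)
            (hqI.1.trans hqb)
        have e2 : b = t := by
          by_contra hne
          exact hno t ⟨ht, fun h => lt_irrefl _ h.2⟩ (haq.trans hqI.2)
            (lt_of_le_of_ne htb (Ne.symm hne))
        rw [e1, e2, hst]
      · push Not at hex
        exact hgap a ha.1 b hb.1 hab fun q hq h h' => absurd (hex q hq h) (not_le.2 h')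
  exact (hK.le_of_le hL sdiff_subset hr).2 ⟨hsr, hrt⟩

theorem continuousOn_of_isGreatest_image {K : Set ℝ} (hK : IsCompact K) {g F : ℝ → ℝ}
    (hg : Continuous g) (hF : ∀ t ∈ K, IsGreatest (g '' (K ∩ Iic t)) (F t)) :
    ContinuousOn F K := by
  have huc := (hK.uniformContinuousOn_of_continuous hg.continuousOn)
  rw [Metric.uniformContinuousOn_iff_le] at huc
  rw [Metric.continuousOn_iff]
  intro t ht ε hε
  obtain ⟨δ, hδ, h⟩ := huc (ε / 2) (by linarith)
  have key : ∀ s ∈ K, ∀ t ∈ K, s ≤ t → dist s t < δ → dist (F s) (F t) < ε := by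
    intro s hs t ht hst hd
    have h1 : F s ≤ F t := (hF t ht).2 (image_mono (inter_subset_inter_right _ (Iic_subset_Iic.2 hst))
      (hF s hs).1)
    obtain ⟨r, ⟨hr, hrt⟩, hrF⟩ := (hF t ht).1
    have h2 : F t ≤ F s + ε / 2 := by
      rcases le_total r s with h3 | h3
      · have := (hF s hs).2 (mem_image_of_mem g ⟨hr, h3⟩)
        linarith
      · have h4 := h r hr s hs (by
          rw [Real.dist_eq, abs_le] at *
          rw [abs_lt] at hd
          have : r ≤ t := hrt
          constructor <;> linarith)
        rw [Real.dist_eq, abs_le] at h4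
        have := (hF s hs).2 (mem_image_of_mem g ⟨hs, le_refl s⟩)
        linarith
    rw [Real.dist_eq, abs_lt]
    constructor <;> linarith
  refine ⟨δ, hδ, fun s hs hst => ?_⟩
  rcases le_total s t with h1 | h1
  · exact key s hs t ht h1 hst
  · rw [dist_comm]
    exact key t ht s hs h1 (by rwa [dist_comm])

theorem exists_separating_functions (X : Type*) [MetricSpace X] [SecondCountableTopology X] :
    ∃ G : ℕ → X → ℝ, (∀ n, Continuous (G n)) ∧ (∀ n x, 0 ≤ G n x) ∧ (∀ n x, G n x ≤ 1) ∧
      ∀ P : Set X, IsClosed P → P.Nonempty → ∀ x ∉ P, ∃ n, 0 < G n x ∧ ∀ y ∈ P, G n y = 0 := by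
  obtain ⟨b, hbc, -, hb⟩ := TopologicalSpace.exists_countable_basis X
  rcases b.eq_empty_or_nonempty with rfl | hne
  · refine ⟨fun _ _ => 0, fun _ => continuous_const, fun _ _ => le_rfl, fun _ _ => zero_le_one,
      fun P hP _ x hx => ?_⟩
    obtain ⟨V, hV, -⟩ := hb.exists_subset_of_mem_open hx hP.isOpen_compl
    exact absurd hV (notMem_empty _)
  · obtain ⟨V, rfl⟩ := hbc.exists_eq_range hne
    refine ⟨fun n x => min 1 (infDist x (V n)ᶜ),
      fun n => continuous_const.min (continuous_infDist_pt _),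
      fun n x => le_min zero_le_one infDist_nonneg, fun n x => min_le_left _ _,
      fun P hP hPne x hx => ?_⟩
    obtain ⟨_, ⟨n, rfl⟩, hxV, hVP⟩ := hb.exists_subset_of_mem_open hx hP.isOpen_compl
    have hsub : P ⊆ (V n)ᶜ := subset_compl_comm.1 hVP
    refine ⟨n, lt_min zero_lt_one ?_, fun y hy => ?_⟩
    · exact ((hb.isOpen ⟨n, rfl⟩).isClosed_compl.notMem_iff_infDist_pos (hPne.mono hsub)).1
        (fun h => h hxV)
    · change min 1 (infDist y (V n)ᶜ) = 0
      rw [infDist_zero_of_mem (hsub hy)]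
      simp

theorem exists_monotone_parameter {X : Type*} [MetricSpace X] [SecondCountableTopology X]
    {γ : ℝ → X} (hγ : Continuous γ) {K : Set ℝ} (hK : IsCompact K)
    (hinj : ∀ s ∈ K, ∀ t ∈ K, γ s = γ t → ∀ r ∈ K, s < r → r < t → False) :
    ∃ φ : ℝ → ℝ, ContinuousOn φ K ∧
      (∀ s ∈ K, ∀ t ∈ K, s < t → γ s ≠ γ t → φ s < φ t) ∧
      ∀ s ∈ K, ∀ t ∈ K, γ s = γ t → φ s = φ t := by
  obtain ⟨G, hGc, hG0, hG1, hG⟩ := exists_separating_functions X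
  have hex : ∀ n t, ∃ v, t ∈ K → IsGreatest ((fun t => G n (γ t)) '' (K ∩ Iic t)) v := by
    intro n t
    by_cases ht : t ∈ K
    · obtain ⟨v, hv⟩ := ((hK.inter_right isClosed_Iic).image ((hGc n).comp hγ)).exists_isGreatest
        ⟨_, mem_image_of_mem _ ⟨ht, le_refl t⟩⟩
      exact ⟨v, fun _ => hv⟩
    · exact ⟨0, fun h => absurd h ht⟩
  choose F hF using hex
  have hF0 : ∀ n, ∀ t ∈ K, 0 ≤ F n t := by
    intro n t ht
    obtain ⟨r, -, hr⟩ := (hF n t ht).1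
    rw [← hr]; exact hG0 _ _
  have hF1 : ∀ n, ∀ t ∈ K, F n t ≤ 1 := by
    intro n t ht
    obtain ⟨r, -, hr⟩ := (hF n t ht).1
    rw [← hr]; exact hG1 _ _
  have hsum : ∀ t ∈ K, Summable fun n => (1 / 2 : ℝ) ^ n * F n t := fun t ht =>
    Summable.of_nonneg_of_le (fun n => mul_nonneg (by positivity) (hF0 n t ht))
      (fun n => mul_le_of_le_one_right (by positivity) (hF1 n t ht)) summable_geometric_two
  have hmono : ∀ n, ∀ s ∈ K, ∀ t ∈ K, s ≤ t → F n s ≤ F n t := fun n s hs t ht hst =>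
    (hF n t ht).2 (image_mono (inter_subset_inter_right _ (Iic_subset_Iic.2 hst)) (hF n s hs).1)
  refine ⟨fun t => ∑' n, (1 / 2 : ℝ) ^ n * F n t, ?_, ?_, ?_⟩
  · refine continuousOn_tsum (fun n => ?_) summable_geometric_two fun n t ht => ?_
    · exact continuousOn_const.mul
        (continuousOn_of_isGreatest_image hK ((hGc n).comp hγ) (hF n))
    · rw [Real.norm_of_nonneg (mul_nonneg (by positivity) (hF0 n t ht))]
      exact mul_le_of_le_one_right (by positivity) (hF1 n t ht)
  · intro s hs t ht hst hne
    obtain ⟨n, hn, hn0⟩ := hG (γ '' (K ∩ Iic s))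
      ((hK.inter_right isClosed_Iic).image hγ).isClosed ⟨_, mem_image_of_mem γ ⟨hs, le_refl s⟩⟩
      (γ t) (by
        rintro ⟨r, ⟨hr, hrs⟩, hrt⟩
        rcases eq_or_lt_of_le (show r ≤ s from hrs) with rfl | hlt
        · exact hne hrt
        · exact hinj r hr t ht hrt s hs hlt hst)
    refine Summable.tsum_lt_tsum (i := n) (fun k => ?_) ?_ (hsum s hs) (hsum t ht)
    · exact mul_le_mul_of_nonneg_left (hmono k s hs t ht hst.le) (by positivity)
    · refine mul_lt_mul_of_pos_left ?_ (by positivity)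
      obtain ⟨r, hr, hrF⟩ := (hF n s hs).1
      rw [← hrF]
      change G n (γ r) < _
      rw [hn0 _ (mem_image_of_mem γ hr)]
      exact hn.trans_le ((hF n t ht).2 (mem_image_of_mem _ ⟨ht, le_refl t⟩))
  · have key : ∀ s ∈ K, ∀ t ∈ K, s < t → γ s = γ t → ∀ n, F n s = F n t := by
      intro s hs t ht hst he n
      refine le_antisymm (hmono n s hs t ht hst.le) ?_
      obtain ⟨r, ⟨hr, hrt⟩, hrF⟩ := (hF n t ht).1
      rw [← hrF]
      rcases le_or_gt r s with h | h
      · exact (hF n s hs).2 ⟨r, ⟨hr, h⟩, rfl⟩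
      · have : r = t := by
          by_contra hne
          exact hinj s hs t ht he r hr h (lt_of_le_of_ne hrt hne)
        exact (hF n s hs).2 ⟨s, ⟨hs, le_refl s⟩, by simp only [this, he]⟩
    intro s hs t ht he
    refine tsum_congr fun n => ?_
    rcases lt_trichotomy s t with h | rfl | h
    · rw [key s hs t ht h he]
    · rfl
    · rw [key t ht s hs h he.symm]

/-- The restriction of `f` to the nondegenerate interval `[a, b]` parametrizes an arc. -/
def IsArcOn {X : Type*} [TopologicalSpace X] (f : ℝ → X) (a b : ℝ) : Prop :=
  a < b ∧ ContinuousOn f (Icc a b) ∧ InjOn f (Icc a b)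

theorem exists_arc_of_path {X : Type*} [MetricSpace X] [SecondCountableTopology X]
    {γ : ℝ → X} (hγ : Continuous γ) (hne : γ 0 ≠ γ 1) :
    ∃ (f : ℝ → X) (a b : ℝ), IsArcOn f a b ∧ f a = γ 0 ∧ f b = γ 1 ∧
      f '' Icc a b ⊆ γ '' Icc 0 1 := by
  obtain ⟨K, h01, hcl, h0, h1, hgap, hinj⟩ := exists_minimal_gapsClosed hγ
  have hK : IsCompact K := isCompact_Icc.of_isClosed_subset hcl h01
  obtain ⟨φ, hφ, hlt, heq⟩ := exists_monotone_parameter hγ hK hinj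
  have hle : ∀ s ∈ K, ∀ t ∈ K, s ≤ t → φ s ≤ φ t := by
    intro s hs t ht hst
    rcases eq_or_lt_of_le hst with rfl | hst
    · rfl
    · by_cases he : γ s = γ t
      · exact (heq s hs t ht he).le
      · exact (hlt s hs t ht hst he).le
  have hφγ : ∀ s ∈ K, ∀ t ∈ K, φ s = φ t → γ s = γ t := by
    intro s hs t ht he
    by_contra hne
    rcases lt_trichotomy s t with h | rfl | h
    · exact (hlt s hs t ht h hne).ne he
    · exact hne rfl
    · exact (hlt t ht s hs h (Ne.symm hne)).ne he.symm
  have hsurj : ∀ v, ∃ t, v ∈ Icc (φ 0) (φ 1) → t ∈ K ∧ φ t = v := by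
    intro v
    by_cases hv : v ∈ Icc (φ 0) (φ 1)
    swap
    · exact ⟨0, fun h => absurd h hv⟩
    have hcomp : ∀ C : Set ℝ, IsClosed C → IsCompact (K ∩ φ ⁻¹' C) := fun C hC =>
      hK.of_isClosed_subset (hφ.preimage_isClosed_of_isClosed hcl hC) inter_subset_left
    obtain ⟨s, ⟨hs, hsv⟩, hsm⟩ := (hcomp (Iic v) isClosed_Iic).exists_isGreatest ⟨0, h0, hv.1⟩
    obtain ⟨t, ⟨ht, htv⟩, htm⟩ := (hcomp (Ici v) isClosed_Ici).exists_isLeast ⟨1, h1, hv.2⟩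
    by_cases hts : t ≤ s
    · exact ⟨s, fun _ => ⟨hs, le_antisymm hsv (le_trans htv (hle t ht s hs hts))⟩⟩
    · have he := heq s hs t ht (hgap s hs t ht (not_le.1 hts) fun r hr hsr hrt => by
        rcases le_total (φ r) v with h | h
        · exact absurd (hsm ⟨hr, h⟩) (not_le.2 hsr)
        · exact absurd (htm ⟨hr, h⟩) (not_le.2 hrt))
      exact ⟨s, fun _ => ⟨hs, le_antisymm hsv (le_trans htv he.ge)⟩⟩
  choose τ hτ using hsurj
  have hab : φ 0 < φ 1 := hlt 0 h0 1 h1 one_pos hne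
  refine ⟨fun v => γ (τ v), φ 0, φ 1, ⟨hab, ?_, ?_⟩, ?_, ?_, ?_⟩
  · rw [continuousOn_iff_isClosed]
    intro C hC
    refine ⟨φ '' (K ∩ γ ⁻¹' C),
      ((hK.inter_right (hC.preimage hγ)).image_of_continuousOn (hφ.mono inter_subset_left)).isClosed,
      ?_⟩
    ext v
    constructor
    · rintro ⟨hvC, hv⟩
      exact ⟨⟨τ v, ⟨(hτ v hv).1, hvC⟩, (hτ v hv).2⟩, hv⟩
    · rintro ⟨⟨t, ⟨ht, htC⟩, rfl⟩, hv⟩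
      refine ⟨?_, hv⟩
      change γ (τ (φ t)) ∈ C
      rwa [hφγ _ (hτ _ hv).1 t ht (hτ _ hv).2]
  · intro v hv w hw he
    rw [← (hτ v hv).2, ← (hτ w hw).2]
    exact heq _ (hτ v hv).1 _ (hτ w hw).1 he
  · have hv := hτ (φ 0) (left_mem_Icc.2 hab.le)
    exact hφγ _ hv.1 _ h0 hv.2
  · have hv := hτ (φ 1) (right_mem_Icc.2 hab.le)
    exact hφγ _ hv.1 _ h1 hv.2
  · rintro _ ⟨v, hv, rfl⟩
    exact mem_image_of_mem γ (h01 (hτ v hv).1)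

theorem JoinedIn.exists_arc {X : Type*} [MetricSpace X] [SecondCountableTopology X]
    {W : Set X} {x y : X} (h : JoinedIn W x y) (hne : x ≠ y) :
    ∃ (f : ℝ → X) (a b : ℝ), IsArcOn f a b ∧ f a = x ∧ f b = y ∧ f '' Icc a b ⊆ W := by
  obtain ⟨p, hp⟩ := h
  obtain ⟨f, a, b, hf, ha, hb, hsub⟩ := exists_arc_of_path p.continuous_extend
    (by simpa using hne)
  refine ⟨f, a, b, hf, by simpa using ha, by simpa using hb, hsub.trans ?_⟩
  rintro _ ⟨t, ht, rfl⟩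
  rw [p.extend_apply ht]
  exact hp _

theorem exists_circle_of_two_arcs {X : Type*} [TopologicalSpace X] {f g : ℝ → X} {a b c d : ℝ}
    (hf : IsArcOn f a b) (hg : IsArcOn g c d) (hbc : f b = g c) (had : f a = g d)
    (hdisj : ∀ r ∈ Icc a b, ∀ w ∈ Icc c d, f r = g w → r = a ∨ r = b) :
    ∃ F : Circle → X, Continuous F ∧ Function.Injective F := by
  obtain ⟨hab, hfc, hfi⟩ := hf
  obtain ⟨hcd, hgc, hgi⟩ := hg
  obtain ⟨p, hp⟩ : ∃ p, p = (b - a) + (d - c) := ⟨_, rfl⟩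
  have hp0 : 0 < p := by linarith
  have : Fact (0 < p) := ⟨hp0⟩
  let L : ℝ → X := fun t => if t ≤ b then f t else g (t - b + c)
  have hLf : ∀ t, t ≤ b → L t = f t := fun t ht => if_pos ht
  have hLg : ∀ t, b < t → L t = g (t - b + c) := fun t ht => if_neg (not_le.2 ht)
  have hLc : ContinuousOn L (Icc a (a + p)) := by
    rw [← Icc_union_Icc_eq_Icc hab.le (by linarith : b ≤ a + p)]
    refine ContinuousOn.union_of_isClosed ?_ ?_ isClosed_Icc isClosed_Icc
    · exact hfc.congr fun t ht => hLf t ht.2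
    · have : ContinuousOn (fun t => g (t - b + c)) (Icc b (a + p)) :=
        hgc.comp (by fun_prop) fun t ht => ⟨by linarith [ht.1], by linarith [ht.2]⟩
      refine this.congr fun t ht => ?_
      rcases eq_or_lt_of_le ht.1 with rfl | h
      · rw [hLf _ le_rfl, hbc]
        simp
      · exact hLg t h
  have hLe : L a = L (a + p) := by
    rw [hLf a hab.le, hLg _ (by linarith), had]
    congr 1
    linarith
  have hmix : ∀ t ∈ Ico a (a + p), ∀ u ∈ Ico a (a + p), t ≤ b → b < u → L t ≠ L u := by
    intro t ht u hu htb hbu he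
    rw [hLf t htb, hLg u hbu] at he
    have hw : u - b + c ∈ Icc c d := ⟨by linarith, by linarith [hu.2]⟩
    rcases hdisj t ⟨ht.1, htb⟩ _ hw he with rfl | rfl
    · have := hgi hw (right_mem_Icc.2 hcd.le) (he.symm.trans had)
      linarith [hu.2]
    · have := hgi hw (left_mem_Icc.2 hcd.le) (he.symm.trans hbc)
      linarith
  have hLi : InjOn L (Ico a (a + p)) := by
    intro t ht u hu he
    rcases le_or_gt t b with h1 | h1 <;> rcases le_or_gt u b with h2 | h2
    · rw [hLf t h1, hLf u h2] at he
      exact hfi ⟨ht.1, h1⟩ ⟨hu.1, h2⟩ he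
    · exact absurd he (hmix t ht u hu h1 h2)
    · exact absurd he.symm (hmix u hu t ht h2 h1)
    · rw [hLg t h1, hLg u h2] at he
      have := hgi ⟨by linarith, by linarith [ht.2]⟩ ⟨by linarith, by linarith [hu.2]⟩ he
      linarith
  have hinj : Function.Injective (AddCircle.liftIco p a L) := by
    intro s t hst
    obtain ⟨s, hs, rfl⟩ : s ∈ ((↑) : ℝ → AddCircle p) '' Ico a (a + p) := by
      rw [AddCircle.coe_image_Ico_eq]; trivial
    obtain ⟨t, ht, rfl⟩ : t ∈ ((↑) : ℝ → AddCircle p) '' Ico a (a + p) := by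
      rw [AddCircle.coe_image_Ico_eq]; trivial
    rw [AddCircle.liftIco_coe_apply hs, AddCircle.liftIco_coe_apply ht] at hst
    rw [hLi hs ht hst]
  exact ⟨AddCircle.liftIco p a L ∘ (AddCircle.homeomorphCircle hp0.ne').symm,
    (AddCircle.liftIco_continuous hLe hLc).comp (Homeomorph.continuous _),
    hinj.comp (Homeomorph.injective _)⟩

theorem IsArcOn.mono {X : Type*} [TopologicalSpace X] {f : ℝ → X} {a b a' b' : ℝ}
    (hf : IsArcOn f a b) (ha : a ≤ a') (hb : b' ≤ b) (hab : a' < b') : IsArcOn f a' b' :=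
  ⟨hab, hf.2.1.mono (Icc_subset_Icc ha hb), hf.2.2.mono (Icc_subset_Icc ha hb)⟩

theorem IsArcOn.comp_neg {X : Type*} [TopologicalSpace X] {f : ℝ → X} {a b : ℝ}
    (hf : IsArcOn f a b) : IsArcOn (fun t => f (-t)) (-b) (-a) := by
  obtain ⟨hab, hc, hi⟩ := hf
  have hm : MapsTo (fun t : ℝ => -t) (Icc (-b) (-a)) (Icc a b) := fun t ht =>
    ⟨by linarith [ht.2], by linarith [ht.1]⟩
  exact ⟨by linarith, hc.comp continuous_neg.continuousOn hm,
    hi.comp neg_injective.injOn hm⟩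

/-- If an interior point of an arc is avoided by another arc with the same end points, then the
union of both arcs contains a simple closed curve. -/
theorem exists_circle_of_arc_avoiding {X : Type*} [TopologicalSpace X] [T2Space X] {f g : ℝ → X}
    {a b c d t : ℝ} (hf : IsArcOn f a b) (hg : IsArcOn g c d) (hac : f a = g c) (hbd : f b = g d)
    (ht : t ∈ Icc a b) (htg : f t ∉ g '' Icc c d) :
    ∃ F : Circle → X, Continuous F ∧ Function.Injective F := by
  have hgK : IsClosed (g '' Icc c d) := (isCompact_Icc.image_of_continuousOn hg.2.1).isClosed
  have hcl : IsClosed (Icc a b ∩ f ⁻¹' (g '' Icc c d)) :=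
    hf.2.1.preimage_isClosed_of_isClosed isClosed_Icc hgK
  have hcomp : IsCompact (Icc a b ∩ f ⁻¹' (g '' Icc c d)) :=
    isCompact_Icc.of_isClosed_subset hcl inter_subset_left
  obtain ⟨s, ⟨⟨hs, hsg⟩, hst⟩, hsm⟩ := (hcomp.inter_right isClosed_Iic).exists_isGreatest
    ⟨a, ⟨left_mem_Icc.2 hf.1.le, c, left_mem_Icc.2 hg.1.le, hac.symm⟩, ht.1⟩
  obtain ⟨u, ⟨⟨hu, hug⟩, htu⟩, hum⟩ := (hcomp.inter_right isClosed_Ici).exists_isLeast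
    ⟨b, ⟨right_mem_Icc.2 hf.1.le, d, right_mem_Icc.2 hg.1.le, hbd.symm⟩, ht.2⟩
  have hst' : s < t := lt_of_le_of_ne hst (by rintro rfl; exact htg hsg)
  have htu' : t < u := lt_of_le_of_ne htu (by rintro rfl; exact htg hug)
  obtain ⟨p, hp, hps⟩ := hsg
  obtain ⟨q, hq, hqu⟩ := hug
  have hdisj : ∀ r ∈ Icc s u, ∀ w ∈ Icc c d, f r = g w → r = s ∨ r = u := by
    intro r hr w hw he
    have hr' : r ∈ Icc a b ∩ f ⁻¹' (g '' Icc c d) :=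
      ⟨⟨hs.1.trans hr.1, hr.2.trans hu.2⟩, w, hw, he.symm⟩
    rcases le_total r t with h | h
    · exact Or.inl (le_antisymm (hsm ⟨hr', h⟩) hr.1)
    · exact Or.inr (le_antisymm hr.2 (hum ⟨hr', h⟩))
  have hfsu := hf.mono hs.1 hu.2 (hst'.trans htu')
  rcases lt_trichotomy p q with h | rfl | h
  · refine exists_circle_of_two_arcs hfsu (hg.mono hp.1 hq.2 h).comp_neg (by simp [hqu])
      (by simp [hps]) fun r hr w hw he => hdisj r hr (-w) ⟨?_, ?_⟩ he
    · linarith [hw.2, hp.1]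
    · linarith [hw.1, hq.2]
  · have := hf.2.2 hs hu (hps.symm.trans hqu)
    linarith
  · exact exists_circle_of_two_arcs hfsu (hg.mono hq.1 hp.2 h) hqu.symm hps.symm
      fun r hr w hw he => hdisj r hr w ⟨hq.1.trans hw.1, hw.2.trans hp.2⟩ he

/-- `z` belongs to every open connected set containing `p` and `q`. -/
def Between {X : Type*} [TopologicalSpace X] (p q z : X) : Prop :=
  ∀ W : Set X, IsOpen W → IsPreconnected W → p ∈ W → q ∈ W → z ∈ W

theorem Between.trans {X : Type*} [TopologicalSpace X] {e a b c : X} (h : Between e b a)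
    (h' : Between e c b) : Between e c a := fun W hW hWc he hc => h W hW hWc he (h' W hW hWc he hc)

theorem Between.image {X : Type*} [TopologicalSpace X] {p q z : X} (hz : Between p q z)
    (h : X ≃ₜ X) : Between (h p) (h q) (h z) := fun W hW hWc hp hq =>
  hz (h ⁻¹' W) (hW.preimage h.continuous) (h.isPreconnected_preimage.2 hWc) hp hq

theorem exists_between_mem_nhds {X : Type*} [MetricSpace X] [CompactSpace X]
    [PreconnectedSpace X] [LocallyConnectedSpace X]
    (hnocircle : ¬ ∃ f : Circle → X, Continuous f ∧ Function.Injective f) {e x : X} (hx : e ≠ x)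
    {N : Set X} (hN : N ∈ 𝓝 e) : ∃ q, q ≠ e ∧ q ∈ N ∧ Between e x q := by
  obtain ⟨f, a, b, hf, hfa, hfb, -⟩ := (isPreconnected_univ.joinedIn_of_isOpen isOpen_univ
    (mem_univ e) (mem_univ x)).exists_arc hx
  have hlim : ∀ᶠ t in 𝓝[Ioo a b] a, f t ∈ N :=
    ((hf.2.1 a (left_mem_Icc.2 hf.1.le)).mono Ioo_subset_Icc_self).eventually (hfa ▸ hN)
  have := left_nhdsWithin_Ioo_neBot hf.1
  obtain ⟨t, htN, ht⟩ := (hlim.and self_mem_nhdsWithin).exists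
  refine ⟨f t, fun he => ?_, htN, fun W hW hWc heW hxW => ?_⟩
  · exact ht.1.ne' (hf.2.2 (Ioo_subset_Icc_self ht) (left_mem_Icc.2 hf.1.le) (he.trans hfa.symm))
  · by_contra htW
    obtain ⟨g, c, d, hg, hgc, hgd, hgW⟩ := (hWc.joinedIn_of_isOpen hW heW hxW).exists_arc hx
    exact hnocircle (exists_circle_of_arc_avoiding hf hg (hfa.trans hgc.symm) (hfb.trans hgd.symm)
      (Ioo_subset_Icc_self ht) fun h => htW (hgW h))

theorem exists_isOpen_isPreconnected_subset {X : Type*} [TopologicalSpace X]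
    [LocallyConnectedSpace X] {x : X} {N : Set X} (hN : N ∈ 𝓝 x) :
    ∃ V ⊆ N, IsOpen V ∧ x ∈ V ∧ IsPreconnected V := by
  obtain ⟨V, h1, h2, h3, h4⟩ := locallyConnectedSpace_iff_subsets_isOpen_isConnected.1 ‹_› x N hN
  exact ⟨V, h1, h2, h3, h4.isPreconnected⟩

theorem mem_closure_connectedComponentIn_compl {X : Type*} [TopologicalSpace X] [T1Space X]
    [PreconnectedSpace X] [LocallyConnectedSpace X] {b c : X} (hbc : c ≠ b) :
    b ∈ closure (connectedComponentIn {b}ᶜ c) := by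
  by_contra hb
  have hc : c ∈ ({b}ᶜ : Set X) := hbc
  have hsub : closure (connectedComponentIn {b}ᶜ c) ⊆ connectedComponentIn {b}ᶜ c :=
    isPreconnected_connectedComponentIn.closure.subset_connectedComponentIn
      (subset_closure (mem_connectedComponentIn hc)) fun y hy hyb => hb (hyb ▸ hy)
  have hclopen : IsClopen (connectedComponentIn {b}ᶜ c) :=
    ⟨isClosed_of_closure_subset hsub, isOpen_compl_singleton.connectedComponentIn⟩
  have := hclopen.eq_univ ⟨c, mem_connectedComponentIn hc⟩
  exact hb (subset_closure (this ▸ mem_univ b))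

/-- The component of `c` in the complement of `b` can be enlarged to an open connected
neighbourhood of `b` that avoids a given point `a` outside this component. -/
theorem exists_enlarged_component {X : Type*} [TopologicalSpace X] [T1Space X]
    [PreconnectedSpace X] [LocallyConnectedSpace X] {a b c : X} (hbc : c ≠ b) (hab : a ≠ b)
    (ha : a ∉ connectedComponentIn {b}ᶜ c) :
    ∃ V : Set X, IsOpen V ∧ IsPreconnected V ∧ c ∈ V ∧ b ∈ V ∧ a ∉ V := by
  obtain ⟨V, hVa, hVo, hbV, hVc⟩ := exists_isOpen_isPreconnected_subset
    (isOpen_compl_singleton.mem_nhds (show b ∈ ({a}ᶜ : Set X) from hab.symm))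
  obtain ⟨y, hyV, hyC⟩ := mem_closure_iff.1 (mem_closure_connectedComponentIn_compl hbc) V hVo hbV
  refine ⟨connectedComponentIn {b}ᶜ c ∪ V,
    isOpen_compl_singleton.connectedComponentIn.union hVo,
    isPreconnected_connectedComponentIn.union y hyC hyV hVc,
    Or.inl (mem_connectedComponentIn hbc), Or.inr hbV, ?_⟩
  rintro (h | h)
  · exact ha h
  · exact hVa h rfl

theorem Between.total {X : Type*} [TopologicalSpace X] [T1Space X]
    [PreconnectedSpace X] [LocallyConnectedSpace X] {e a b c : X}
    (ha : Between e c a) (hb : Between e c b) : Between e b a ∨ Between e a b := by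
  by_cases hca : c = a
  · exact Or.inr (hca ▸ hb)
  by_contra! hcon
  obtain ⟨h1, h2⟩ := hcon
  simp only [Between, not_forall] at h1 h2
  obtain ⟨W₁, ho₁, hc₁, he₁, hb₁, ha₁⟩ := h1
  obtain ⟨W₂, ho₂, hc₂, he₂, ha₂, hb₂⟩ := h2
  have hba : b ≠ a := by rintro rfl; exact ha₁ hb₁
  have hbC : b ∉ connectedComponentIn {a}ᶜ c := by
    intro hbC
    have := ha _ (isOpen_compl_singleton.connectedComponentIn.union ho₁)
      (isPreconnected_connectedComponentIn.union b hbC hb₁ hc₁) (Or.inr he₁)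
      (Or.inl (mem_connectedComponentIn hca))
    rcases this with h | h
    · exact connectedComponentIn_subset _ _ h rfl
    · exact ha₁ h
  obtain ⟨V, hVo, hVc, hcV, haV, hbV⟩ := exists_enlarged_component hca hba hbC
  rcases hb _ (hVo.union ho₂) (hVc.union a haV ha₂ hc₂) (Or.inr he₂) (Or.inl hcV) with h | h
  · exact hbV h
  · exact hb₂ h

theorem Between.right_of_between {X : Type*} [TopologicalSpace X] [T1Space X]
    [PreconnectedSpace X] [LocallyConnectedSpace X] {e a b c : X}
    (ha : Between e b a) (hb : Between e c b) : Between a c b := by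
  intro W hWo hWc haW hcW
  by_contra hbW
  have hab : a ≠ b := by rintro rfl; exact hbW haW
  by_cases heb : e = b
  · subst heb
    obtain ⟨V, hVa, hVo, heV, hVc⟩ := exists_isOpen_isPreconnected_subset
      (isOpen_compl_singleton.mem_nhds (show e ∈ ({a}ᶜ : Set X) from hab.symm))
    exact hVa (ha V hVo hVc heV heV) rfl
  · by_cases haC : a ∈ connectedComponentIn {b}ᶜ e
    · rcases hb _ (isOpen_compl_singleton.connectedComponentIn.union hWo)
        (isPreconnected_connectedComponentIn.union a haC haW hWc)
        (Or.inl (mem_connectedComponentIn heb)) (Or.inr hcW) with h | h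
      · exact connectedComponentIn_subset _ _ h rfl
      · exact hbW h
    · obtain ⟨V, hVo, hVc, heV, hbV, haV⟩ := exists_enlarged_component heb hab haC
      exact haV (ha V hVo hVc heV hbV)

theorem exists_isPreconnected_notMem_closure {X : Type*} [TopologicalSpace X] [T2Space X]
    [LocallyConnectedSpace X] {e x y : X} (hend : IsPreconnected {x : X | x ≠ e})
    (hx : x ≠ e) (hy : y ≠ e) :
    ∃ W : Set X, IsOpen W ∧ IsPreconnected W ∧ x ∈ W ∧ y ∈ W ∧ e ∉ closure W := by
  refine hend.induction₂ (fun x y => ∃ W : Set X, IsOpen W ∧ IsPreconnected W ∧ x ∈ W ∧ y ∈ W ∧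
    e ∉ closure W) (fun a ha => ?_) ?_ ?_ hx hy
  · obtain ⟨U, V, hU, hV, haU, heV, hUV⟩ := t2_separation (show a ≠ e from ha)
    obtain ⟨W, hWU, hWo, haW, hWc⟩ := exists_isOpen_isPreconnected_subset (hU.mem_nhds haU)
    filter_upwards [mem_nhdsWithin_of_mem_nhds (hWo.mem_nhds haW)] with b hb
    exact ⟨W, hWo, hWc, haW, hb, fun h =>
      disjoint_left.1 ((hUV.mono_left hWU).closure_left hV) h heV⟩
  · rintro a b c - - - ⟨W, hWo, hWc, haW, hbW, heW⟩ ⟨W', hWo', hWc', hbW', hcW', heW'⟩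
    refine ⟨W ∪ W', hWo.union hWo', hWc.union b hbW hbW' hWc', Or.inl haW, Or.inr hcW', ?_⟩
    rw [closure_union]
    exact fun h => h.elim heW heW'
  · rintro a b - - ⟨W, hWo, hWc, haW, hbW, heW⟩
    exact ⟨W, hWo, hWc, hbW, haW, heW⟩

/-- If `h` moves `q` away from the fixed point `e`, then the iterates of `q` converge to a fixed
point other than `e`. -/
theorem exists_fixed_of_between {X : Type*} [TopologicalSpace X] [T2Space X] [CompactSpace X]
    [PreconnectedSpace X] [LocallyConnectedSpace X] (h : X ≃ₜ X) {e q : X} (hfix : h e = e)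
    (hq : q ≠ e) (hb : Between e (h q) q) : ∃ o, o ≠ e ∧ h o = o := by
  have hsucc : ∀ n, Between e (h^[n + 1] q) (h^[n] q) := by
    intro n
    induction n with
    | zero => exact hb
    | succ n ih =>
      have := ih.image h
      rwa [hfix, ← Function.iterate_succ_apply' h, ← Function.iterate_succ_apply' h] at this
  have hle : ∀ m n, m ≤ n → Between e (h^[n] q) (h^[m] q) := by
    intro m n hmn
    induction n, hmn using Nat.le_induction with
    | base => exact fun W _ _ _ h => h
    | succ n _ ih => exact ih.trans (hsucc n)
  obtain ⟨o, -, ho⟩ := isCompact_univ.exists_mapClusterPt (f := atTop) (u := fun n => h^[n] q)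
    (by simp)
  have hfreq : ∀ W ∈ 𝓝 o, ∃ᶠ n in atTop, h^[n] q ∈ W := mapClusterPt_iff_frequently.1 ho
  have hlim : Tendsto (fun n => h^[n] q) atTop (𝓝 o) := by
    intro N hN
    obtain ⟨W, hWN, hWo, hoW, hWc⟩ := exists_isOpen_isPreconnected_subset hN
    have hf := Filter.frequently_atTop.1 (hfreq W (hWo.mem_nhds hoW))
    obtain ⟨m, -, hm⟩ := hf 0
    refine mem_map.2 (mem_atTop_sets.2 ⟨m, fun k hk => hWN ?_⟩)
    obtain ⟨n, hn, hnW⟩ := hf k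
    exact (hle m k hk).right_of_between (hle k n hn) W hWo hWc hm hnW
  refine ⟨o, ?_, ?_⟩
  · rintro rfl
    obtain ⟨W, hWq, hWo, hoW, hWc⟩ := exists_isOpen_isPreconnected_subset
      (isOpen_compl_singleton.mem_nhds (show o ∈ ({q}ᶜ : Set X) from hq.symm))
    obtain ⟨n, hn⟩ := (hfreq W (hWo.mem_nhds hoW)).exists
    exact hWq (hle 0 n n.zero_le W hWo hWc hoW hn) rfl
  · have h1 : Tendsto (fun n => h (h^[n] q)) atTop (𝓝 (h o)) :=
      (h.continuous.tendsto o).comp hlim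
    have h2 := hlim.comp (tendsto_add_atTop_nat 1)
    refine tendsto_nhds_unique h1 (h2.congr fun n => ?_)
    exact Function.iterate_succ_apply' _ _ _

theorem stmt_15 {X : Type*} [TopologicalSpace X] [CompactSpace X]
    [ConnectedSpace X] [LocallyConnectedSpace X] [TopologicalSpace.MetrizableSpace X] [T2Space X]
    [Nontrivial X]
    (hnocircle : ¬ ∃ f : Circle → X, Continuous f ∧ Function.Injective f)
    (h : X ≃ₜ X) (e : X)
    (hend : IsConnected {x : X | x ≠ e})
    (hfix : h e = e) :
    ∃ o : X, o ≠ e ∧ h o = o := by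
  let _ : MetricSpace X := TopologicalSpace.metrizableSpaceMetric X
  obtain ⟨x, hx⟩ := hend.nonempty
  have hhx : h x ≠ e := fun he => hx (h.injective (he.trans hfix.symm))
  obtain ⟨W, hWo, hWc, hxW, hhxW, heW⟩ :=
    exists_isPreconnected_notMem_closure hend.isPreconnected hx hhx
  have hN : h ⁻¹' (closure W)ᶜ ∈ 𝓝 e := h.continuous.continuousAt.preimage_mem_nhds
    (isClosed_closure.isOpen_compl.mem_nhds (by rwa [hfix]))
  obtain ⟨q, hqe, hhqN, hq⟩ := exists_between_mem_nhds hnocircle (Ne.symm hx) hN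
  have hhq : Between e x (h q) := by
    intro V hVo hVc heV hxV
    have := hq.image h
    rw [hfix] at this
    rcases this _ (hVo.union hWo) (hVc.union x hxV hxW hWc) (Or.inl heV) (Or.inr hhxW) with h1 | h1
    · exact h1
    · exact absurd (subset_closure h1) hhqN
  rcases hq.total hhq with h1 | h1
  · exact exists_fixed_of_between h hfix hqe h1
  · have hhqe : h q ≠ e := fun he => hqe (h.injective (he.trans hfix.symm))
    obtain ⟨o, hoe, ho⟩ := exists_fixed_of_between h.symm (h.symm_apply_eq.2 hfix.symm) hhqe
      (by rwa [h.symm_apply_apply])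
    exact ⟨o, hoe, (h.symm_apply_eq.1 ho).symm⟩
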